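/- Basis-preserving executions are safe (abstract form of the paper's Lemma 3.1(a)): let Σ be a type of concurrent states, T a type of threads, V a type of program points with a distinguished quiescent point w, and pc : Σ → T → V. Let μ : V → (Σ → T → Prop) assign an invariant to each program point and pm : V → Set (Σ → T → Prop) a basis such that for every u, μ u is a positive boolean combination over pm u. Call thread t active in σ if pc σ t ≠ w, and safe in σ if μ (pc σ t) σ t; call σ safe if every active thread is safe in it. Let σ₀, σ₁, …, σₙ be states together with, for each step i, an executing thread tᵢ, such that: (i) no thread is active in σ₀; (ii) for every thread t ≠ tᵢ active in σᵢ, pc σᵢ₊₁ t = pc σᵢ t and every φ ∈ pm (pc σᵢ t) with φ σᵢ t also satisfies φ σᵢ₊₁ t, and every thread t ≠ tᵢ inactive in σᵢ is inactive in σᵢ₊₁; (iii) if tᵢ is active and safe in σᵢ then tᵢ is inactive or safe in σᵢ₊₁, and if tᵢ is inactive in σᵢ then tᵢ is inactive or safe in σᵢ₊₁. Then every state σᵢ is safe. -/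

import Mathlib

/-- A positive boolean combination over a set `S` of thread-indexed predicates:
built from members of `S` by finitely many pointwise conjunctions and disjunctions. -/
inductive PosComb {St T : Type*} (S : Set (St → T → Prop)) : (St → T → Prop) → Prop
  | base {p : St → T → Prop} : p ∈ S → PosComb S p
  | and {p q : St → T → Prop} : PosComb S p → PosComb S q →
      PosComb S (fun σ t => p σ t ∧ q σ t)
  | or {p q : St → T → Prop} : PosComb S p → PosComb S q →
      PosComb S (fun σ t => p σ t ∨ q σ t)

/-- Positive boolean combinations over `S` are preserved whenever the members of `S` are. -/
theorem PosComb.mono_of_basis {St T : Type*} {S : Set (St → T → Prop)} {p : St → T → Prop}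
    (hp : PosComb S p) {s s' : St} {t : T} (h : ∀ φ ∈ S, φ s t → φ s' t) :
    p s t → p s' t := by
  induction hp with
  | base hmem => exact h _ hmem
  | and _ _ ihp ihq => exact And.imp ihp ihq
  | or _ _ ihp ihq => exact Or.imp ihp ihq

/-- Basis-preserving executions are safe: in an execution `σ 0, …, σ n` with executing
threads `tex i`, if (i) no thread is active initially, (ii) each step preserves the
program counter, activity status and true basis predicates of every non-executing
thread, and (iii) the executing thread, if active and safe (or inactive), is inactive
or safe after the step, then every state of the execution is safe. -/
theorem basis_preserving_safe {St T V : Type*} (w : V) (pc : St → T → V)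
    (μ : V → (St → T → Prop)) (pm : V → Set (St → T → Prop))
    (hbasis : ∀ u : V, PosComb (pm u) (μ u))
    (n : ℕ) (σ : ℕ → St) (tex : ℕ → T)
    (h0 : ∀ t : T, pc (σ 0) t = w)
    (hii : ∀ i < n, ∀ t : T, t ≠ tex i →
      (pc (σ i) t ≠ w →
        pc (σ (i + 1)) t = pc (σ i) t ∧
        ∀ φ ∈ pm (pc (σ i) t), φ (σ i) t → φ (σ (i + 1)) t) ∧
      (pc (σ i) t = w → pc (σ (i + 1)) t = w))
    (hiii : ∀ i < n,
      (pc (σ i) (tex i) ≠ w → μ (pc (σ i) (tex i)) (σ i) (tex i) →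
        pc (σ (i + 1)) (tex i) = w ∨
          μ (pc (σ (i + 1)) (tex i)) (σ (i + 1)) (tex i)) ∧
      (pc (σ i) (tex i) = w →
        pc (σ (i + 1)) (tex i) = w ∨
          μ (pc (σ (i + 1)) (tex i)) (σ (i + 1)) (tex i))) :
    ∀ i ≤ n, ∀ t : T, pc (σ i) t ≠ w → μ (pc (σ i) t) (σ i) t := by
  intro i
  induction i with
  | zero => exact fun _ t ht => absurd (h0 t) ht
  | succ i ih =>
    intro hi t ht
    have hin : i < n := hi
    by_cases hact : pc (σ i) t = w
    · by_cases hte : t = tex i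
      · subst hte
        exact ((hiii i hin).2 hact).resolve_left ht
      · exact absurd ((hii i hin t hte).2 hact) ht
    · have hsafe := ih hin.le t hact
      by_cases hte : t = tex i
      · subst hte
        exact ((hiii i hin).1 hact hsafe).resolve_left ht
      · obtain ⟨hpc, hpres⟩ := (hii i hin t hte).1 hact
        rw [hpc]
        exact (hbasis _).mono_of_basis hpres hsafe
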